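/- arXiv:2601.23116 — 2 statements merged into one kernel-verified Lean document; each statement's English description precedes it below -/
import Mathlib

section
/- Let F = {ρ_F} be a singleton set of free states on ℂ^d (a pointed quantum resource theory). Then the free encoding capacity is faithful: for every density matrix ρ on ℂ^d, C_F(ρ) = 0 if and only if ρ = ρ_F. In particular, C_F(ρ_F) = 0 since every free channel leaves ρ_F invariant, and for every ρ ≠ ρ_F one has C_F(ρ) ≥ sup_{p ∈ [0,1]} [ S(p ρ + (1−p) ρ_F) − p S(ρ) − (1−p) S(ρ_F) ] > 0. -/
open scoped BigOperators ComplexOrder Matrix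

namespace FECpaper

/-- Square complex matrices of size `d`, the ambient space for states on `ℂ^d`. -/
abbrev Mat (d : ℕ) := Matrix (Fin d) (Fin d) ℂ

/-- A density matrix: positive semidefinite with unit trace. -/
def IsDensityMatrix {d : ℕ} (ρ : Mat d) : Prop := ρ.PosSemidef ∧ ρ.trace = 1

/-- Von Neumann entropy (base 2), via eigenvalues; junk value `0` for non-Hermitian input.
Note `Real.logb 2 0 = 0`, so the convention `0 · log₂ 0 = 0` holds automatically. -/
noncomputable def entropy {d : ℕ} (ρ : Mat d) : ℝ :=
  if h : ρ.IsHermitian then -∑ i, h.eigenvalues i * Real.logb 2 (h.eigenvalues i) else 0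

/-- A quantum channel: a map admitting a Kraus representation with `∑ k, (L k)ᴴ * L k = 1`. -/
def IsChannel {d : ℕ} (N : Mat d → Mat d) : Prop :=
  ∃ (n : ℕ) (L : Fin n → Mat d),
    (∑ k, (L k)ᴴ * L k) = 1 ∧ ∀ A, N A = ∑ k, L k * A * (L k)ᴴ

/-- A free channel for the set `F` of free states: a channel mapping `F` into `F`. -/
def IsFreeChannel {d : ℕ} (F : Set (Mat d)) (N : Mat d → Mat d) : Prop :=
  IsChannel N ∧ ∀ σ ∈ F, N σ ∈ F

/-- A (finitely supported) probability distribution. -/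
def IsProb {ι : Type*} [Fintype ι] (p : ι → ℝ) : Prop :=
  (∀ x, 0 ≤ p x) ∧ ∑ x, p x = 1

/-- Holevo quantity of a finite ensemble of states:
`χ = S(∑ₓ pₓ ρₓ) − ∑ₓ pₓ S(ρₓ)`. -/
noncomputable def holevo {d : ℕ} {ι : Type*} [Fintype ι] (p : ι → ℝ) (ρs : ι → Mat d) : ℝ :=
  entropy (∑ x, p x • ρs x) - ∑ x, p x * entropy (ρs x)

/-- Free encoding capacity of a state `ρ` for the resource theory with free states `F`:
the supremum of Holevo quantities of ensembles obtained from `ρ` by free channels. -/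
noncomputable def FEC {d : ℕ} (F : Set (Mat d)) (ρ : Mat d) : ℝ :=
  sSup {c : ℝ | ∃ (n : ℕ) (p : Fin n → ℝ) (N : Fin n → (Mat d → Mat d)),
    IsProb p ∧ (∀ x, IsFreeChannel F (N x)) ∧ c = holevo p (fun x => N x ρ)}

/-- A stochastically free operation: a Kraus family with `∑ k, (L k)ᴴ * L k = 1` each of
whose members maps every free state to a nonnegative scalar multiple of a free state. -/
def IsStochFree {d : ℕ} (F : Set (Mat d)) {n : ℕ} (L : Fin n → Mat d) : Prop :=
  (∑ k, (L k)ᴴ * L k) = 1 ∧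
  ∀ k, ∀ σ ∈ F, ∃ (c : ℝ) (τ : Mat d), 0 ≤ c ∧ τ ∈ F ∧ L k * σ * (L k)ᴴ = c • τ

lemma entropy_eq {d : ℕ} {ρ : Mat d} (h : ρ.IsHermitian) :
    entropy ρ = (∑ i, Real.negMulLog (h.eigenvalues i)) / Real.log 2 := by
  unfold entropy
  rw [dif_pos h, Finset.sum_div, ← Finset.sum_neg_distrib]
  refine Finset.sum_congr rfl fun i _ => ?_
  simp only [Real.negMulLog, Real.logb]
  ring

lemma log2_pos : 0 < Real.log 2 := Real.log_pos (by norm_num)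

lemma sum_eigenvalues {d : ℕ} {ρ : Mat d} (h : IsDensityMatrix ρ) :
    ∑ i, h.1.1.eigenvalues i = 1 := by
  have := h.2.symm.trans h.1.1.trace_eq_sum_eigenvalues
  have h2 := congrArg Complex.re this
  simpa using h2.symm

lemma entropy_nonneg {d : ℕ} {ρ : Mat d} (h : IsDensityMatrix ρ) : 0 ≤ entropy ρ := by
  rw [entropy_eq h.1.1]
  refine div_nonneg (Finset.sum_nonneg fun i _ => ?_) log2_pos.le
  refine Real.negMulLog_nonneg (h.1.eigenvalues_nonneg i) ?_
  rw [← sum_eigenvalues h]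
  exact Finset.single_le_sum (f := h.1.1.eigenvalues)
    (fun j _ => h.1.eigenvalues_nonneg j) (Finset.mem_univ i)

lemma entropy_le {d : ℕ} {ρ : Mat d} (h : IsDensityMatrix ρ) :
    entropy ρ ≤ d / Real.log 2 := by
  rw [entropy_eq h.1.1]
  refine div_le_div_of_nonneg_right ?_ log2_pos.le
  calc ∑ i, Real.negMulLog (h.1.1.eigenvalues i) ≤ ∑ i : Fin d, (1 : ℝ) := by
        refine Finset.sum_le_sum fun i _ => ?_
        have := h.1.eigenvalues_nonneg i
        linarith [Real.negMulLog_le_one_sub_self this]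
    _ = d := by simp

lemma density_sum {d : ℕ} {ι : Type*} [Fintype ι] {p : ι → ℝ} (hp : IsProb p) {ρs : ι → Mat d}
    (h : ∀ x, IsDensityMatrix (ρs x)) : IsDensityMatrix (∑ x, p x • ρs x) := by
  refine ⟨Matrix.posSemidef_sum _ fun x _ => (h x).1.smul (hp.1 x), ?_⟩
  rw [Matrix.trace_sum]
  simp only [Matrix.trace_smul, (h _).2]
  have := congrArg (fun r : ℝ => (r : ℂ)) hp.2
  simpa using this

lemma density_mix {d : ℕ} {ρ σ : Mat d} (hρ : IsDensityMatrix ρ) (hσ : IsDensityMatrix σ)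
    {p : ℝ} (h0 : 0 ≤ p) (h1 : p ≤ 1) : IsDensityMatrix (p • ρ + (1 - p) • σ) := by
  refine ⟨(hρ.1.smul h0).add (hσ.1.smul (sub_nonneg.2 h1)), ?_⟩
  rw [Matrix.trace_add, Matrix.trace_smul, Matrix.trace_smul, hρ.2, hσ.2, ← add_smul]
  simp

lemma density_channel {d : ℕ} {N : Mat d → Mat d} (hN : IsChannel N) {ρ : Mat d}
    (h : IsDensityMatrix ρ) : IsDensityMatrix (N ρ) := by
  obtain ⟨n, L, hL, hN⟩ := hN
  rw [hN]
  refine ⟨Matrix.posSemidef_sum _ fun k _ => h.1.mul_mul_conjTranspose_same _, ?_⟩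
  rw [Matrix.trace_sum]
  have : ∀ k, (L k * ρ * (L k)ᴴ).trace = (((L k)ᴴ * L k) * ρ).trace := fun k => by
    rw [Matrix.trace_mul_comm, Matrix.mul_assoc]
  simp only [this]
  rw [← Matrix.trace_sum, ← Finset.sum_mul, hL, one_mul, h.2]

lemma holevo_le {d : ℕ} {ι : Type*} [Fintype ι] {p : ι → ℝ} (hp : IsProb p) {ρs : ι → Mat d}
    (h : ∀ x, IsDensityMatrix (ρs x)) : holevo p ρs ≤ d / Real.log 2 := by
  unfold holevo
  have h1 := entropy_le (density_sum hp h)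
  have h2 : 0 ≤ ∑ x, p x * entropy (ρs x) :=
    Finset.sum_nonneg fun x _ => mul_nonneg (hp.1 x) (entropy_nonneg (h x))
  linarith

lemma id_channel {d : ℕ} : IsChannel (fun A : Mat d => A) :=
  ⟨1, fun _ => 1, by simp, by simp⟩

open scoped MatrixOrder Matrix.Norms.L2Operator in
lemma const_channel {d : ℕ} {σ : Mat d} (h : IsDensityMatrix σ) :
    IsChannel (fun A : Mat d => A.trace • σ) := by
  obtain ⟨B, hB⟩ := (CStarAlgebra.nonneg_iff_eq_star_mul_self (a := σ)).1 h.1.nonneg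
  rw [Matrix.star_eq_conjTranspose] at hB
  refine ⟨d * d, fun k => Bᴴ * Matrix.single (finProdFinEquiv.symm k).1
    (finProdFinEquiv.symm k).2 (1 : ℂ), ?_, fun A => ?_⟩
  · rw [finProdFinEquiv.symm.sum_comp (fun q : Fin d × Fin d =>
      (Bᴴ * Matrix.single q.1 q.2 (1 : ℂ))ᴴ * (Bᴴ * Matrix.single q.1 q.2 (1 : ℂ))),
      Fintype.sum_prod_type_right]
    have ht : ∑ i, (B * Bᴴ) i i = 1 := by
      have := h.2
      rw [hB, Matrix.trace_mul_comm] at this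
      exact this
    have : ∀ i j : Fin d, (Bᴴ * Matrix.single i j (1 : ℂ))ᴴ * (Bᴴ * Matrix.single i j (1 : ℂ))
        = Matrix.single j j ((B * Bᴴ) i i) := by
      intro i j
      rw [Matrix.conjTranspose_mul, Matrix.conjTranspose_conjTranspose,
        Matrix.conjTranspose_single, ← Matrix.mul_assoc, Matrix.mul_assoc _ B,
        Matrix.single_mul_mul_single]
      simp
    simp only [this]
    ext a b
    simp only [Matrix.sum_apply, Matrix.single_apply, Matrix.one_apply]
    by_cases hab : a = b
    · subst hab
      simp [ht]
    · simp only [hab, if_false]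
      refine Finset.sum_eq_zero fun j _ => Finset.sum_eq_zero fun i _ => if_neg ?_
      rintro ⟨rfl, h2⟩
      exact hab h2
  · rw [finProdFinEquiv.symm.sum_comp (fun q : Fin d × Fin d =>
      (Bᴴ * Matrix.single q.1 q.2 (1 : ℂ)) * A * (Bᴴ * Matrix.single q.1 q.2 (1 : ℂ))ᴴ),
      Fintype.sum_prod_type]
    have : ∀ i j : Fin d, (Bᴴ * Matrix.single i j (1 : ℂ)) * A * (Bᴴ * Matrix.single i j (1 : ℂ))ᴴ
        = Bᴴ * Matrix.single i i (A j j) * B := by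
      intro i j
      rw [Matrix.conjTranspose_mul, Matrix.conjTranspose_conjTranspose,
        Matrix.conjTranspose_single, ← Matrix.mul_assoc, Matrix.mul_assoc Bᴴ,
        Matrix.mul_assoc Bᴴ, Matrix.single_mul_mul_single]
      simp
    simp only [this]
    simp only [← Finset.sum_mul, ← Finset.mul_sum]
    have h3 : ∑ i : Fin d, ∑ j : Fin d, Matrix.single i i (A j j) = A.trace • (1 : Mat d) := by
      ext a b
      simp only [Matrix.sum_apply, Matrix.single_apply, Matrix.smul_apply, Matrix.one_apply]
      by_cases hab : a = b
      · subst hab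
        rw [Finset.sum_eq_single a]
        · simp [Matrix.trace]
        · intro i _ hi
          simp [hi]
        · simp
      · simp only [hab, if_false, smul_zero]
        refine Finset.sum_eq_zero fun j _ => Finset.sum_eq_zero fun i _ => if_neg ?_
        rintro ⟨rfl, h2⟩
        exact hab h2
    rw [h3]
    simp [← hB]

/-- Peierls-type inequality with the equality case. -/
lemma peierls {d : ℕ} {ρ U : Mat d} (hρ : ρ.PosSemidef) (hU : Uᴴ * U = 1) :
    (∀ i, 0 ≤ ((Uᴴ * ρ * U) i i).re) ∧
    (∑ i, Real.negMulLog (hρ.1.eigenvalues i) ≤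
      ∑ i, Real.negMulLog ((Uᴴ * ρ * U) i i).re) ∧
    (∑ i, Real.negMulLog ((Uᴴ * ρ * U) i i).re ≤ ∑ i, Real.negMulLog (hρ.1.eigenvalues i) →
      Uᴴ * ρ * U = Matrix.diagonal (fun i => ((((Uᴴ * ρ * U) i i).re : ℝ) : ℂ))) := by
  set l := hρ.1.eigenvalues with hl
  have hl0 : ∀ j, 0 ≤ l j := hρ.eigenvalues_nonneg
  set V : Mat d := (hρ.1.eigenvectorUnitary : Mat d) with hV
  have hV1 : Vᴴ * V = 1 := Unitary.coe_star_mul_self hρ.1.eigenvectorUnitary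
  have hV2 : V * Vᴴ = 1 := Unitary.coe_mul_star_self hρ.1.eigenvectorUnitary
  have hU2 : U * Uᴴ = 1 := mul_eq_one_comm.1 hU
  have hspec : ρ = V * Matrix.diagonal (fun i => (l i : ℂ)) * Vᴴ := hρ.1.spectral_theorem
  set W : Mat d := Uᴴ * V with hW
  have hW1 : W * Wᴴ = 1 := by
    rw [hW, Matrix.conjTranspose_mul, Matrix.conjTranspose_conjTranspose, Matrix.mul_assoc,
      ← Matrix.mul_assoc V, hV2, Matrix.one_mul, hU]
  have hW2 : Wᴴ * W = 1 := mul_eq_one_comm.1 hW1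
  have hD : Uᴴ * ρ * U = W * Matrix.diagonal (fun i => (l i : ℂ)) * Wᴴ := by
    rw [hspec, hW, Matrix.conjTranspose_mul, Matrix.conjTranspose_conjTranspose]
    simp only [Matrix.mul_assoc]
  set w : Fin d → Fin d → ℝ := fun i j => Complex.normSq (W i j) with hw
  have hw0 : ∀ i j, 0 ≤ w i j := fun i j => Complex.normSq_nonneg _
  have hrow : ∀ i, ∑ j, w i j = 1 := by
    intro i
    have := congrFun (congrFun hW1 i) i
    simp only [Matrix.mul_apply, Matrix.conjTranspose_apply, Matrix.one_apply_eq] at this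
    have h2 := congrArg Complex.re this
    simpa [Complex.mul_conj, hw] using h2
  have hcol : ∀ j, ∑ i, w i j = 1 := by
    intro j
    have := congrFun (congrFun hW2 j) j
    simp only [Matrix.mul_apply, Matrix.conjTranspose_apply, Matrix.one_apply_eq] at this
    have h2 := congrArg Complex.re this
    simpa [mul_comm, Complex.mul_conj, hw] using h2
  have ha : ∀ i, ((Uᴴ * ρ * U) i i).re = ∑ j, w i j • l j := by
    intro i
    rw [hD, Matrix.mul_apply]
    simp only [Matrix.mul_diagonal, Matrix.conjTranspose_apply, Complex.re_sum]
    refine Finset.sum_congr rfl fun j _ => ?_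
    simp only [hw, Complex.normSq_apply, smul_eq_mul]
    simp
    ring
  have hJ : ∀ i, ∑ j, w i j • Real.negMulLog (l j) ≤ Real.negMulLog (∑ j, w i j • l j) :=
    fun i => Real.concaveOn_negMulLog.le_map_sum (fun j _ => hw0 i j) (hrow i)
      (fun j _ => hl0 j)
  have hS : ∑ i, ∑ j, w i j • Real.negMulLog (l j) = ∑ j, Real.negMulLog (l j) := by
    rw [Finset.sum_comm]
    refine Finset.sum_congr rfl fun j _ => ?_
    rw [← Finset.sum_smul, hcol, one_smul]
  refine ⟨fun i => ?_, ?_, fun hle => ?_⟩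
  · rw [ha]
    exact Finset.sum_nonneg fun j _ => mul_nonneg (hw0 i j) (hl0 j)
  · rw [← hS]
    simp only [ha]
    exact Finset.sum_le_sum fun i _ => hJ i
  · rw [← hS] at hle
    simp only [ha] at hle
    have heq := (Finset.sum_eq_sum_iff_of_le (fun i _ => hJ i)).1
      (le_antisymm (Finset.sum_le_sum fun i _ => hJ i) hle)
    have hlj : ∀ i j, w i j ≠ 0 → l j = ∑ k, w i k • l k := fun i j hij =>
      (Real.strictConcaveOn_negMulLog.map_sum_eq_iff' (fun j _ => hw0 i j) (hrow i)
        (fun j _ => hl0 j)).1 (heq i (Finset.mem_univ i)).symm j (Finset.mem_univ j) hij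
    have hcomm : W * Matrix.diagonal (fun i => (l i : ℂ)) =
        Matrix.diagonal (fun i => ((((Uᴴ * ρ * U) i i).re : ℝ) : ℂ)) * W := by
      ext i j
      rw [Matrix.mul_diagonal, Matrix.diagonal_mul, ha]
      by_cases hij : W i j = 0
      · simp [hij]
      · rw [hlj i j (by simpa [hw] using hij), mul_comm]
    conv_lhs => rw [hD]
    rw [hcomm, Matrix.mul_assoc, hW1, Matrix.mul_one]

/-- Strict concavity of the entropy at the midpoint. -/
lemma entropy_midpoint {d : ℕ} {ρ σ : Mat d} (hρ : IsDensityMatrix ρ) (hσ : IsDensityMatrix σ)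
    (hne : ρ ≠ σ) :
    0 < entropy ((1 / 2 : ℝ) • ρ + (1 - 1 / 2 : ℝ) • σ) - (1 / 2) * entropy ρ
      - (1 - 1 / 2) * entropy σ := by
  have hτ : IsDensityMatrix ((1 / 2 : ℝ) • ρ + (1 - 1 / 2 : ℝ) • σ) :=
    density_mix hρ hσ (by norm_num) (by norm_num)
  set τ := (1 / 2 : ℝ) • ρ + (1 - 1 / 2 : ℝ) • σ with hτd
  set U : Mat d := (hτ.1.1.eigenvectorUnitary : Mat d) with hUd
  have hU1 : Uᴴ * U = 1 := Unitary.coe_star_mul_self hτ.1.1.eigenvectorUnitary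
  have hU2 : U * Uᴴ = 1 := Unitary.coe_mul_star_self hτ.1.1.eigenvectorUnitary
  have hspec : τ = U * Matrix.diagonal (fun i => (hτ.1.1.eigenvalues i : ℂ)) * Uᴴ :=
    hτ.1.1.spectral_theorem
  have hdiag : Uᴴ * τ * U = Matrix.diagonal (fun i => (hτ.1.1.eigenvalues i : ℂ)) := by
    conv_lhs => rw [hspec]
    rw [← Matrix.mul_assoc, ← Matrix.mul_assoc, hU1, Matrix.one_mul, Matrix.mul_assoc, hU1,
      Matrix.mul_one]
  obtain ⟨ha0, ha1, ha2⟩ := peierls hρ.1 hU1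
  obtain ⟨hb0, hb1, hb2⟩ := peierls hσ.1 hU1
  set a : Fin d → ℝ := fun i => ((Uᴴ * ρ * U) i i).re with had
  set b : Fin d → ℝ := fun i => ((Uᴴ * σ * U) i i).re with hbd
  have hmid : ∀ i, hτ.1.1.eigenvalues i = (1 / 2 : ℝ) • a i + (1 / 2 : ℝ) • b i := by
    intro i
    have h1 : ((Uᴴ * τ * U) i i).re = hτ.1.1.eigenvalues i := by rw [hdiag]; simp
    rw [← h1, hτd, Matrix.mul_add, Matrix.add_mul, Matrix.mul_smul, Matrix.smul_mul,
      Matrix.mul_smul, Matrix.smul_mul, Matrix.add_apply, Matrix.smul_apply, Matrix.smul_apply,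
      Complex.add_re, Complex.smul_re, Complex.smul_re]
    norm_num [had, hbd]
  have hJ : ∀ i, (1 / 2 : ℝ) • Real.negMulLog (a i) + (1 / 2 : ℝ) • Real.negMulLog (b i) ≤
      Real.negMulLog (hτ.1.1.eigenvalues i) := by
    intro i
    rw [hmid]
    exact Real.concaveOn_negMulLog.2 (ha0 i) (hb0 i) (by norm_num) (by norm_num) (by norm_num)
  have hsum := Finset.sum_le_sum (s := Finset.univ) fun i _ => hJ i
  have hexp : ∑ i, ((1 / 2 : ℝ) • Real.negMulLog (a i) + (1 / 2 : ℝ) • Real.negMulLog (b i)) =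
      (1 / 2) * ∑ i, Real.negMulLog (a i) + (1 / 2) * ∑ i, Real.negMulLog (b i) := by
    rw [Finset.sum_add_distrib, Finset.mul_sum, Finset.mul_sum]
    rfl
  have key : (1 / 2) * ∑ i, Real.negMulLog (hρ.1.1.eigenvalues i) +
      (1 / 2) * ∑ i, Real.negMulLog (hσ.1.1.eigenvalues i) <
      ∑ i, Real.negMulLog (hτ.1.1.eigenvalues i) := by
    by_contra hcon
    push Not at hcon
    have h1 := ha2 (by simp only [had] at hexp; linarith)
    have h2 := hb2 (by linarith)
    have h3 := (Finset.sum_eq_sum_iff_of_le (s := Finset.univ) fun i _ => hJ i).1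
      (le_antisymm hsum (by linarith))
    have hab : ∀ i, a i = b i := by
      intro i
      by_contra hab
      have := Real.strictConcaveOn_negMulLog.2 (ha0 i) (hb0 i) hab
        (show (0 : ℝ) < 1 / 2 by norm_num) (show (0 : ℝ) < 1 / 2 by norm_num) (by norm_num)
      rw [← hmid, ← h3 i (Finset.mem_univ i)] at this
      exact lt_irrefl _ this
    have h4 : Uᴴ * ρ * U = Uᴴ * σ * U := by
      rw [h1, h2]
      congr 1
      funext i
      exact congrArg _ (hab i)
    apply hne
    have h5 : ∀ X : Mat d, U * (Uᴴ * X * U) * Uᴴ = X := fun X => by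
      rw [← Matrix.mul_assoc, ← Matrix.mul_assoc, hU2, Matrix.one_mul, Matrix.mul_assoc, hU2,
        Matrix.mul_one]
    rw [← h5 ρ, h4, h5]
  rw [entropy_eq hτ.1.1, entropy_eq hρ.1.1, entropy_eq hσ.1.1]
  have h6 := div_lt_div_of_pos_right key log2_pos
  rw [add_div, mul_div_assoc, mul_div_assoc] at h6
  linarith

lemma FEC_bdd {d : ℕ} (F : Set (Mat d)) {ρ : Mat d} (hρ : IsDensityMatrix ρ) :
    BddAbove {c : ℝ | ∃ (n : ℕ) (p : Fin n → ℝ) (N : Fin n → (Mat d → Mat d)),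
    IsProb p ∧ (∀ x, IsFreeChannel F (N x)) ∧ c = holevo p (fun x => N x ρ)} := by
  refine ⟨d / Real.log 2, ?_⟩
  rintro c ⟨n, p, N, hp, hN, rfl⟩
  exact holevo_le hp fun x => density_channel (hN x).1 hρ

lemma FEC_free {d : ℕ} (ρF : Mat d) : FEC {ρF} ρF = 0 := by
  unfold FEC
  have : {c : ℝ | ∃ (n : ℕ) (p : Fin n → ℝ) (N : Fin n → (Mat d → Mat d)),
      IsProb p ∧ (∀ x, IsFreeChannel {ρF} (N x)) ∧ c = holevo p (fun x => N x ρF)} = {0} := by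
    ext c
    simp only [Set.mem_ofPred_eq, Set.mem_singleton_iff]
    constructor
    · rintro ⟨n, p, N, hp, hN, rfl⟩
      have h1 : ∀ x, N x ρF = ρF := fun x => (hN x).2 ρF rfl
      simp only [holevo, h1]
      rw [← Finset.sum_smul, ← Finset.sum_mul, hp.2]
      simp
    · rintro rfl
      refine ⟨1, fun _ => 1, fun _ A => A, ⟨by simp, by simp⟩,
        fun _ => ⟨id_channel, fun σ h => h⟩, ?_⟩
      simp [holevo]
  rw [this, csSup_singleton]

lemma FEC_ge {d : ℕ} {ρF ρ : Mat d} (hρF : IsDensityMatrix ρF) (hρ : IsDensityMatrix ρ)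
    {p : ℝ} (hp : p ∈ Set.Icc (0 : ℝ) 1) :
    entropy (p • ρ + (1 - p) • ρF) - p * entropy ρ - (1 - p) * entropy ρF ≤ FEC {ρF} ρ := by
  refine le_csSup (FEC_bdd _ hρ) ?_
  refine ⟨2, ![p, 1 - p], ![fun A => A, fun A => A.trace • ρF], ⟨?_, ?_⟩, ?_, ?_⟩
  · intro x
    fin_cases x
    · exact hp.1
    · exact sub_nonneg.2 hp.2
  · simp
  · intro x
    fin_cases x
    · exact ⟨id_channel, fun σ h => h⟩
    · refine ⟨const_channel hρF, ?_⟩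
      rintro σ rfl
      simp [hρF.2]
  · simp [holevo, Fin.sum_univ_two, hρ.2]
    ring

/-- (Faithfulness for pointed resource theories) For `F = {ρF}` a
singleton set of free states, `C_F(ρ) = 0 ↔ ρ = ρF`; in particular `C_F(ρF) = 0`, and
for every density matrix `ρ ≠ ρF`,
`C_F(ρ) ≥ sup_{p ∈ [0,1]} [S(p ρ + (1−p) ρF) − p S(ρ) − (1−p) S(ρF)] > 0`. -/
theorem pointed_FEC_faithful {d : ℕ} (ρF : Mat d) (hρF : IsDensityMatrix ρF) :
    (∀ ρ : Mat d, IsDensityMatrix ρ → (FEC {ρF} ρ = 0 ↔ ρ = ρF)) ∧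
    FEC {ρF} ρF = 0 ∧
    ∀ ρ : Mat d, IsDensityMatrix ρ → ρ ≠ ρF →
      FEC {ρF} ρ ≥ sSup {c : ℝ | ∃ p ∈ Set.Icc (0 : ℝ) 1,
          c = entropy (p • ρ + (1 - p) • ρF) - p * entropy ρ - (1 - p) * entropy ρF} ∧
      0 < sSup {c : ℝ | ∃ p ∈ Set.Icc (0 : ℝ) 1,
          c = entropy (p • ρ + (1 - p) • ρF) - p * entropy ρ - (1 - p) * entropy ρF} := by
  have hlow : ∀ ρ : Mat d, IsDensityMatrix ρ → ρ ≠ ρF →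
      FEC {ρF} ρ ≥ sSup {c : ℝ | ∃ p ∈ Set.Icc (0 : ℝ) 1,
          c = entropy (p • ρ + (1 - p) • ρF) - p * entropy ρ - (1 - p) * entropy ρF} ∧
      0 < sSup {c : ℝ | ∃ p ∈ Set.Icc (0 : ℝ) 1,
          c = entropy (p • ρ + (1 - p) • ρF) - p * entropy ρ - (1 - p) * entropy ρF} := by
    intro ρ hρ hne
    have hmem : entropy ((1 / 2 : ℝ) • ρ + (1 - 1 / 2 : ℝ) • ρF) - (1 / 2) * entropy ρ
        - (1 - 1 / 2) * entropy ρF ∈ {c : ℝ | ∃ p ∈ Set.Icc (0 : ℝ) 1,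
          c = entropy (p • ρ + (1 - p) • ρF) - p * entropy ρ - (1 - p) * entropy ρF} :=
      ⟨1 / 2, ⟨by norm_num, by norm_num⟩, rfl⟩
    have hub : ∀ c ∈ {c : ℝ | ∃ p ∈ Set.Icc (0 : ℝ) 1,
          c = entropy (p • ρ + (1 - p) • ρF) - p * entropy ρ - (1 - p) * entropy ρF},
          c ≤ FEC {ρF} ρ := by
      rintro c ⟨p, hp, rfl⟩
      exact FEC_ge hρF hρ hp
    exact ⟨csSup_le ⟨_, hmem⟩ hub,
      (entropy_midpoint hρ hρF hne).trans_le (le_csSup ⟨_, hub⟩ hmem)⟩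
  refine ⟨fun ρ hρ => ⟨fun h0 => ?_, ?_⟩, FEC_free ρF, hlow⟩
  · by_contra hne
    obtain ⟨h1, h2⟩ := hlow ρ hρ hne
    linarith
  · rintro rfl
    exact FEC_free _

end FECpaper
end

section
/- Consider the resource theory of activity on qubits: the set of free states is P₂ = { diag(q, 1−q) : 1/2 ≤ q ≤ 1 } (the passive qubit states), and the free channels are the quantum channels on ℂ² mapping P₂ into P₂. Then for every active qubit state, i.e. every 2×2 density matrix ρ ∉ P₂, and every passive state σ ∈ P₂, the free encoding capacity satisfies the strict inequality C_{P₂}(ρ) > C_{P₂}(σ). -/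
open scoped BigOperators ComplexOrder Matrix

namespace FECpaper

/-- The set of passive qubit states: `P₂ = {diag(q, 1−q) : 1/2 ≤ q ≤ 1}`. -/
def P2 : Set (Mat 2) :=
  {M | ∃ q : ℝ, 1/2 ≤ q ∧ q ≤ 1 ∧ M = Matrix.diagonal ![(q : ℂ), ((1 - q : ℝ) : ℂ)]}

lemma entropy_exists {M : Mat 2} (hM : M.IsHermitian) (ht : M.trace = 1) :
    ∃ l : ℝ, M.det = ((l * (1 - l) : ℝ) : ℂ) ∧ entropy M = Real.binEntropy l / Real.log 2 ∧
      (M.PosSemidef → 0 ≤ l ∧ l ≤ 1) := by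
  have h1 := hM.trace_eq_sum_eigenvalues
  have h2 := hM.det_eq_prod_eigenvalues
  rw [ht, Fin.sum_univ_two] at h1
  rw [Fin.prod_univ_two] at h2
  have h3 : hM.eigenvalues 1 = 1 - hM.eigenvalues 0 := by
    have : (1 : ℝ) = hM.eigenvalues 0 + hM.eigenvalues 1 := by
      have := congrArg Complex.re h1
      simpa using this
    linarith
  refine ⟨hM.eigenvalues 0, ?_, ?_, ?_⟩
  · rw [h2, h3]; push_cast; rfl
  · unfold entropy
    rw [dif_pos hM, Fin.sum_univ_two, h3, Real.binEntropy_eq_negMulLog_add_negMulLog_one_sub]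
    simp only [Real.negMulLog, Real.logb]
    ring
  · intro hp
    have a := hp.eigenvalues_nonneg 0
    have b := hp.eigenvalues_nonneg 1
    have e : hp.1.eigenvalues = hM.eigenvalues := rfl
    rw [e] at a b
    constructor <;> linarith

lemma entropy_le_one {M : Mat 2} (hM : IsDensityMatrix M) : entropy M ≤ 1 := by
  obtain ⟨l, -, h, -⟩ := entropy_exists hM.1.1 hM.2
  rw [h, div_le_one (Real.log_pos one_lt_two)]
  exact Real.binEntropy_le_log_two

lemma entropy_nonneg_s16 {M : Mat 2} (hM : IsDensityMatrix M) : 0 ≤ entropy M := by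
  obtain ⟨l, -, h, hl⟩ := entropy_exists hM.1.1 hM.2
  rw [h]
  exact div_nonneg (Real.binEntropy_nonneg (hl hM.1).1 (hl hM.1).2) (Real.log_pos one_lt_two).le

/-- The diagonal state `diag(q, 1-q)`. -/
noncomputable def dg (q : ℝ) : Mat 2 := Matrix.diagonal ![(q : ℂ), ((1 - q : ℝ) : ℂ)]

lemma dg_herm (q : ℝ) : (dg q).IsHermitian := by
  unfold dg
  ext i j
  fin_cases i <;> fin_cases j <;> simp [Matrix.diagonal]

lemma entropy_dg (q : ℝ) : entropy (dg q) = Real.binEntropy q / Real.log 2 := by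
  obtain ⟨l, h, h', -⟩ := entropy_exists (dg_herm q) (by simp [dg, Matrix.trace_fin_two])
  rw [h']
  have : q * (1 - q) = l * (1 - l) := by
    have : (dg q).det = ((q * (1 - q) : ℝ) : ℂ) := by
      simp [dg, Matrix.det_diagonal]
    rw [this] at h
    exact_mod_cast h
  have : (q - l) * (1 - l - q) = 0 := by linarith
  rcases mul_eq_zero.1 this with h | h
  · rw [show l = q by linarith]
  · rw [show q = 1 - l by linarith, Real.binEntropy_one_sub]

lemma channel_density {N : Mat 2 → Mat 2} (hN : IsChannel N) {ρ : Mat 2}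
    (hρ : IsDensityMatrix ρ) : IsDensityMatrix (N ρ) := by
  obtain ⟨n, L, h, hL⟩ := hN
  rw [hL]
  constructor
  · exact Matrix.posSemidef_sum _ fun k _ => hρ.1.mul_mul_conjTranspose_same (L k)
  · rw [Matrix.trace_sum]
    have : ∀ k, (L k * ρ * (L k)ᴴ).trace = ((L k)ᴴ * L k * ρ).trace := by
      intro k
      rw [Matrix.trace_mul_comm, Matrix.mul_assoc]
    simp only [this]
    rw [← Matrix.trace_sum, ← Finset.sum_mul, h, one_mul, hρ.2]

lemma mix_density {n : ℕ} {p : Fin n → ℝ} (hp : IsProb p) {r : Fin n → Mat 2}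
    (hr : ∀ x, IsDensityMatrix (r x)) : IsDensityMatrix (∑ x, p x • r x) := by
  constructor
  · exact Matrix.posSemidef_sum _ fun k _ => (hr k).1.smul (hp.1 k)
  · rw [Matrix.trace_sum]
    simp only [Matrix.trace_smul, (hr _).2]
    have := hp.2
    simp only [Complex.real_smul, mul_one]
    exact_mod_cast this

lemma le_FEC {ρ : Mat 2} (hρ : IsDensityMatrix ρ) {n : ℕ} {p : Fin n → ℝ}
    {N : Fin n → (Mat 2 → Mat 2)} (hp : IsProb p) (hN : ∀ x, IsFreeChannel P2 (N x)) :
    holevo p (fun x => N x ρ) ≤ FEC P2 ρ := by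
  apply le_csSup
  · refine ⟨1, ?_⟩
    rintro c ⟨n, p, N, hp, hN, rfl⟩
    have hd := fun x => channel_density (hN x).1 hρ
    have h1 := entropy_le_one (mix_density hp hd)
    have h2 : 0 ≤ ∑ x, p x * entropy (N x ρ) :=
      Finset.sum_nonneg fun x _ => mul_nonneg (hp.1 x) (entropy_nonneg_s16 (hd x))
    unfold holevo
    linarith
  · exact ⟨n, p, N, hp, hN, rfl⟩

lemma binEntropy_chord {q : ℝ} (h1 : 1/2 ≤ q) (h2 : q ≤ 1) :
    2 * (1 - q) * Real.log 2 ≤ Real.binEntropy q := by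
  have := Real.strictConcave_binEntropy.concaveOn.2
    (show (1/2 : ℝ) ∈ Set.Icc (0:ℝ) 1 by norm_num) (show (1 : ℝ) ∈ Set.Icc (0:ℝ) 1 by norm_num)
    (show 0 ≤ 2 * (1 - q) by linarith) (show 0 ≤ 2 * q - 1 by linarith) (by ring)
  simp only [smul_eq_mul, Real.binEntropy_one, one_div, Real.binEntropy_two_inv] at this
  rw [show 2 * (1 - q) * 2⁻¹ + (2 * q - 1) * 1 = q by ring] at this
  linarith

lemma gibbs_aux {x y : ℝ} (hx : 0 ≤ x) (hy : 0 < y) :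
    -x * Real.log x ≤ -x * Real.log y + (y - x) := by
  rcases hx.eq_or_lt with rfl | hx
  · simpa using hy.le
  · have := Real.log_le_sub_one_of_pos (div_pos hy hx)
    rw [Real.log_div hy.ne' hx.ne'] at this
    have h := mul_le_mul_of_nonneg_left this hx.le
    have e : x * (y / x - 1) = y - x := by field_simp
    rw [e] at h
    linarith

lemma log_four_fifths : Real.log (4/5) = 2 * Real.log 2 - Real.log 5 := by
  rw [Real.log_div (by norm_num) (by norm_num), show (4:ℝ) = 2 ^ 2 by norm_num, Real.log_pow]
  norm_num

lemma log_fifth : Real.log (1/5) = - Real.log 5 := by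
  rw [one_div, Real.log_inv]

lemma binEntropy_tangent {q : ℝ} (h1 : 0 ≤ q) (h2 : q ≤ 1) :
    Real.binEntropy q ≤ Real.log 5 - 2 * q * Real.log 2 := by
  have a := gibbs_aux h1 (y := 4/5) (by norm_num)
  have b := gibbs_aux (x := 1 - q) (y := 1/5) (by linarith) (by norm_num)
  rw [log_four_fifths] at a
  rw [log_fifth] at b
  rw [Real.binEntropy_eq_negMulLog_add_negMulLog_one_sub]
  simp only [Real.negMulLog]
  linarith

lemma binEntropy_four_fifths : Real.binEntropy (4/5) = Real.log 5 - 8/5 * Real.log 2 := by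
  rw [Real.binEntropy_eq_negMulLog_add_negMulLog_one_sub]
  simp only [Real.negMulLog]
  rw [show (1 - 4/5 : ℝ) = 1/5 by norm_num, log_four_fifths, log_fifth]
  ring

lemma dg_mix {n : ℕ} {p q : Fin n → ℝ} (hp : IsProb p) :
    ∑ x, p x • dg (q x) = dg (∑ x, p x * q x) := by
  have h : (1 - ∑ x, p x * q x) = ∑ x, p x * (1 - q x) := by
    simp only [mul_sub, Finset.sum_sub_distrib, mul_one, hp.2]
  ext i j
  rw [Matrix.sum_apply]
  unfold dg
  rw [h]
  fin_cases i <;> fin_cases j <;> simp [Matrix.diagonal]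

lemma FEC_passive_le {σ : Mat 2} (hσ : σ ∈ P2) :
    FEC P2 σ ≤ (Real.log 5 - 2 * Real.log 2) / Real.log 2 := by
  have hl := Real.log_pos one_lt_two
  apply Real.sSup_le
  · rintro c ⟨n, p, N, hp, hN, rfl⟩
    have : ∀ x, ∃ q : ℝ, 1/2 ≤ q ∧ q ≤ 1 ∧ N x σ = dg q := fun x => (hN x).2 σ hσ
    choose q hq1 hq2 hq using this
    unfold holevo
    simp only [hq, dg_mix hp, entropy_dg]
    have h0 : 0 ≤ ∑ x, p x * q x :=
      Finset.sum_nonneg fun x _ => mul_nonneg (hp.1 x) (by linarith [hq1 x])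
    have h1 : ∑ x, p x * q x ≤ 1 := by
      rw [← hp.2]
      exact Finset.sum_le_sum fun x _ => mul_le_of_le_one_right (hp.1 x) (hq2 x)
    have h2 := binEntropy_tangent h0 h1
    have h3 : ∑ x, p x * (2 * (1 - q x) * Real.log 2) ≤ ∑ x, p x * Real.binEntropy (q x) :=
      Finset.sum_le_sum fun x _ =>
        mul_le_mul_of_nonneg_left (binEntropy_chord (hq1 x) (hq2 x)) (hp.1 x)
    have h4 : ∑ x, p x * (2 * (1 - q x) * Real.log 2)
        = 2 * Real.log 2 - 2 * (∑ x, p x * q x) * Real.log 2 := by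
      have : ∀ x, p x * (2 * (1 - q x) * Real.log 2)
          = 2 * Real.log 2 * p x - 2 * Real.log 2 * (p x * q x) := fun x => by ring
      simp only [this, Finset.sum_sub_distrib, ← Finset.mul_sum, hp.2]
      ring
    simp only [← mul_div_assoc, ← Finset.sum_div]
    rw [← sub_div]
    apply div_le_div_of_nonneg_right _ hl.le
    linarith
  · apply div_nonneg _ hl.le
    have := Real.log_le_log (x := 4) (y := 5) (by norm_num) (by norm_num)
    rw [show (4:ℝ) = 2 ^ 2 by norm_num, Real.log_pow] at this
    push_cast at this
    linarith

lemma P2_density {σ : Mat 2} (hσ : σ ∈ P2) : σ 0 0 + σ 1 1 = 1 ∧ σ 0 1 = 0 ∧ σ 1 0 = 0 := by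
  obtain ⟨q, h1, h2, rfl⟩ := hσ
  simp

/-- The channel preparing the ground state. -/
noncomputable def N0 (A : Mat 2) : Mat 2 := !![A 0 0 + A 1 1, 0; 0, 0]

lemma N0_free : IsFreeChannel P2 N0 := by
  constructor
  · refine ⟨2, ![!![1, 0; 0, 0], !![0, 1; 0, 0]], ?_, ?_⟩
    · ext i j
      fin_cases i <;> fin_cases j <;>
        simp [Fin.sum_univ_two, Matrix.mul_apply, Matrix.conjTranspose_apply]
    · intro A
      ext i j
      simp only [Fin.sum_univ_two, Matrix.add_apply, Matrix.mul_apply, Matrix.conjTranspose_apply]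
      fin_cases i <;> fin_cases j <;>
        simp [N0]
  · intro σ hσ
    refine ⟨1, by norm_num, le_rfl, ?_⟩
    ext i j
    fin_cases i <;> fin_cases j <;> simp [N0, (P2_density hσ).1]

lemma id_free : IsFreeChannel P2 (fun A : Mat 2 => A) := by
  refine ⟨⟨1, ![1], by simp, fun A => by simp⟩, fun σ h => h⟩

/-- The phase-and-flip channel. -/
noncomputable def NU (u : ℂ) (A : Mat 2) : Mat 2 :=
  !![(A 0 0 + A 1 1) / 2, (A 0 1 * star u + u * A 1 0) / 2;
     (A 0 1 * star u + u * A 1 0) / 2, (A 0 0 + A 1 1) / 2]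

lemma NU_free {u : ℂ} (hu : u * star u = 1) : IsFreeChannel P2 (NU u) := by
  obtain ⟨s, hs1, hs2⟩ : ∃ s : ℂ, star s = s ∧ s * s = 1/2 := by
    refine ⟨((Real.sqrt (1/2) : ℝ) : ℂ), Complex.conj_ofReal _, ?_⟩
    rw [← Complex.ofReal_mul, Real.mul_self_sqrt (by norm_num)]
    norm_num
  simp only [RCLike.star_def] at hs1 hu
  constructor
  · refine ⟨2, ![!![s, 0; 0, s * u], !![0, s * u; s, 0]], ?_, ?_⟩
    · ext i j
      fin_cases i <;> fin_cases j <;>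
        simp [Fin.sum_univ_two, Matrix.mul_apply, Matrix.conjTranspose_apply, hs1]
      · linear_combination 2 * hs2
      · linear_combination 2 * s * s * hu + 2 * hs2
    · intro A
      ext i j
      simp only [Fin.sum_univ_two, Matrix.add_apply, Matrix.mul_apply, Matrix.conjTranspose_apply]
      fin_cases i <;> fin_cases j <;>
        simp [NU, hs1]
      · linear_combination -(A 0 0 + A 1 1 * (u * (starRingEnd ℂ) u)) * hs2 - A 1 1 / 2 * hu
      · linear_combination -(A 0 1 * (starRingEnd ℂ) u + u * A 1 0) * hs2
      · linear_combination -(A 0 1 * (starRingEnd ℂ) u + u * A 1 0) * hs2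
      · linear_combination -(A 0 0 + A 1 1 * (u * (starRingEnd ℂ) u)) * hs2 - A 1 1 / 2 * hu
  · intro σ hσ
    refine ⟨1/2, by norm_num, by norm_num, ?_⟩
    obtain ⟨h1, h2, h3⟩ := P2_density hσ
    ext i j
    fin_cases i <;> fin_cases j <;> simp [NU, h1, h2, h3] <;> norm_num

/-- The state with diagonal `1/2` and real coherence `c`. -/
noncomputable def om (c : ℝ) : Mat 2 := !![1/2, (c : ℂ); (c : ℂ), 1/2]

lemma entropy_om {c : ℝ} (hc : c ≠ 0) : entropy (om c) < 1 := by
  have hh : (om c).IsHermitian := by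
    ext i j
    fin_cases i <;> fin_cases j <;> simp [om]
  obtain ⟨l, h, h', -⟩ := entropy_exists hh (by simp [om, Matrix.trace_fin_two]; norm_num)
  rw [h', div_lt_one (Real.log_pos one_lt_two), Real.binEntropy_lt_log_two]
  rintro rfl
  have e : (om c).det = ((1/4 - c^2 : ℝ) : ℂ) := by
    simp [om, Matrix.det_fin_two]; ring
  rw [e] at h
  have h5 : (1/4 - c^2 : ℝ) = 2⁻¹ * (1 - 2⁻¹) := by exact_mod_cast h
  apply hc
  have : c ^ 2 = 0 := by linarith
  exact pow_eq_zero_iff (two_ne_zero) |>.1 this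

/-- In the resource theory of activity on qubits (free states `P₂`, free
channels the passivity-preserving ones), every active state `ρ ∉ P₂` has strictly larger
free encoding capacity than every passive state `σ ∈ P₂`. -/
theorem FEC_active_gt_passive (ρ : Mat 2) (hρ : IsDensityMatrix ρ) (hact : ρ ∉ P2)
    (σ : Mat 2) (hσ : σ ∈ P2) :
    FEC P2 σ < FEC P2 ρ := by
  have hl := Real.log_pos one_lt_two
  refine (FEC_passive_le hσ).trans_lt ?_
  have htr : ρ 0 0 + ρ 1 1 = 1 := by
    have := hρ.2
    rwa [Matrix.trace_fin_two] at this
  have h10 : ρ 1 0 = star (ρ 0 1) := (hρ.1.1.apply 1 0).symm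
  have hN0 : N0 ρ = dg 1 := by
    ext i j
    fin_cases i <;> fin_cases j <;> simp [N0, dg, htr]
  have he1 : entropy (dg 1) = 0 := by rw [entropy_dg]; simp
  by_cases hb : ρ 0 1 = 0
  · -- diagonal active state
    have hr00 : star (ρ 0 0) = ρ 0 0 := hρ.1.1.apply 0 0
    obtain ⟨a, ha⟩ := Complex.conj_eq_iff_real.1 hr00
    have hρa : ρ = dg a := by
      ext i j
      fin_cases i <;> fin_cases j <;> simp [dg, ha, h10, hb]
      rw [← ha, ← htr]; ring
    have ha0 : 0 ≤ a := by
      have := hρ.1.diag_nonneg (i := 0)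
      rw [ha] at this
      exact_mod_cast this
    have ha2 : a < 1/2 := by
      by_contra hcon
      push Not at hcon
      apply hact
      refine ⟨a, hcon, ?_, hρa⟩
      have := hρ.1.diag_nonneg (i := 1)
      have e : ρ 1 1 = ((1 - a : ℝ) : ℂ) := by
        push_cast; rw [← ha, ← htr]; ring
      rw [e] at this
      have : (0:ℝ) ≤ 1 - a := by exact_mod_cast this
      linarith
    have hs : 0 < 1 - a := by linarith
    set t : ℝ := 1 / (5 * (1 - a)) with ht
    have ht0 : 0 < t := by positivity
    have hta : t * (1 - a) = 1/5 := by rw [ht]; field_simp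
    have htlt : t < 2/5 := by nlinarith
    have hp : IsProb ![1 - t, t] := by
      refine ⟨fun x => ?_, by simp [Fin.sum_univ_two]⟩
      fin_cases x
      · show 0 ≤ 1 - t
        linarith
      · exact ht0.le
    have hN : ∀ x, IsFreeChannel P2 ((![N0, fun A => A] : Fin 2 → (Mat 2 → Mat 2)) x) := by
      intro x
      fin_cases x
      · exact N0_free
      · exact id_free
    refine lt_of_lt_of_le ?_ (le_FEC hρ hp hN)
    have hmix := dg_mix (q := ![1, a]) hp
    have hav : ∑ x, ![1 - t, t] x * ![1, a] x = 4/5 := by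
      simp [Fin.sum_univ_two]; linarith
    rw [hav] at hmix
    simp only [Fin.sum_univ_two, Matrix.cons_val_zero, Matrix.cons_val_one] at hmix
    unfold holevo
    simp only [Fin.sum_univ_two, Matrix.cons_val_zero, Matrix.cons_val_one, hN0, he1]
    have h1 := entropy_le_one hρ
    have h0 := entropy_nonneg_s16 hρ
    have hm : entropy ((1 - t) • dg 1 + t • ρ) = entropy (dg (4/5)) := by
      rw [← hmix, hρa]
    rw [hm, entropy_dg, binEntropy_four_fifths]
    have e1 : (Real.log 5 - 8/5 * Real.log 2) / Real.log 2
        = (Real.log 5 - 2 * Real.log 2) / Real.log 2 + 2/5 := by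
      field_simp; ring
    rw [e1]
    nlinarith
  · -- coherent state
    have hn : ‖ρ 0 1‖ ≠ 0 := by simpa using hb
    set c : ℝ := ‖ρ 0 1‖ with hc
    have hcc : ρ 0 1 * star (ρ 0 1) = (c:ℂ) * c := by
      have := Complex.mul_conj' (ρ 0 1)
      rw [RCLike.star_def, this, hc]; ring
    have hn' : (c : ℂ) ≠ 0 := by exact_mod_cast hn
    have hsc : star (c : ℂ) = c := Complex.conj_ofReal c
    have hu : (ρ 0 1 / c) * star (ρ 0 1 / c) = 1 := by
      rw [star_div₀, hsc, div_mul_div_comm, hcc, div_self (mul_ne_zero hn' hn')]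
    have hu2 : (-(ρ 0 1 / c)) * star (-(ρ 0 1 / c)) = 1 := by
      rw [star_neg, neg_mul_neg, hu]
    have k1 : ρ 0 1 * star (ρ 0 1 / c) = c := by
      rw [star_div₀, hsc, ← mul_div_assoc, hcc, mul_div_assoc, div_self hn', mul_one]
    have k2 : ρ 0 1 / c * ρ 1 0 = c := by
      rw [h10, div_mul_eq_mul_div, hcc, mul_div_assoc, div_self hn', mul_one]
    have e1 : NU (ρ 0 1 / c) ρ = om c := by
      unfold NU om
      rw [htr, k1, k2]
      congr <;> ring
    have e2 : NU (-(ρ 0 1 / c)) ρ = om (-c) := by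
      unfold NU om
      rw [htr, star_neg, mul_neg, neg_mul, k1, k2]
      push_cast
      congr <;> ring
    have hp : IsProb ![(3/5 : ℝ), 1/5, 1/5] := by
      refine ⟨fun x => ?_, by simp [Fin.sum_univ_three]; norm_num⟩
      fin_cases x <;> simp <;> norm_num
    have hN : ∀ x, IsFreeChannel P2
        ((![N0, NU (ρ 0 1 / c), NU (-(ρ 0 1 / c))] : Fin 3 → (Mat 2 → Mat 2)) x) := by
      intro x
      fin_cases x
      · exact N0_free
      · exact NU_free hu
      · exact NU_free hu2
    refine lt_of_lt_of_le ?_ (le_FEC hρ hp hN)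
    have h1 := entropy_om hn
    have h2 := entropy_om (neg_ne_zero.2 hn)
    have hm : (3/5 : ℝ) • dg 1 + (1/5 : ℝ) • om c + (1/5 : ℝ) • om (-c) = dg (4/5) := by
      ext i j
      fin_cases i <;> fin_cases j <;> simp [dg, om] <;> norm_num
    unfold holevo
    simp only [Fin.sum_univ_three, Matrix.cons_val_zero, Matrix.cons_val_one, Matrix.cons_val,
      hN0, he1, e1, e2]
    rw [hm, entropy_dg, binEntropy_four_fifths]
    have e1 : (Real.log 5 - 8/5 * Real.log 2) / Real.log 2
        = (Real.log 5 - 2 * Real.log 2) / Real.log 2 + 2/5 := by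
      field_simp; ring
    rw [e1]
    linarith

end FECpaper
end
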